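/- Let q = exp(πi/14). Define 4×4 complex matrices A = [[1, (q⁸+q⁴+1)q⁴, −(q⁸+q⁴+1)/q², −q¹⁰], [0, q¹², −(q⁴+1)q², −q¹⁰], [0, 0, −q⁶, −q¹⁰], [0, 0, 0, −q¹⁰]] and B = [[−q¹⁰, 0, 0, 0], [q⁶, −q⁶, 0, 0], [q¹⁶, −(q⁴+1)q¹², q¹², 0], [−q¹², q¹²+q⁸+q⁴, −q⁸−q⁴−1, 1]]. Then the subgroup G of GL(4,ℂ) generated by A and B is finite, and the quotient group G/Z(G) of G by its center has order 168. -/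

import Mathlib

/-- The subgroup of `GL(4, ℂ)` generated by the (invertible) matrices `A` and `B`. -/
def matGenGroup (A B : Matrix (Fin 4) (Fin 4) ℂ) :
    Subgroup (Matrix (Fin 4) (Fin 4) ℂ)ˣ :=
  Subgroup.closure {g : (Matrix (Fin 4) (Fin 4) ℂ)ˣ |
    (g : Matrix (Fin 4) (Fin 4) ℂ) = A ∨ (g : Matrix (Fin 4) (Fin 4) ℂ) = B}

section

open Matrix

instance fact_prime_seven : Fact (Nat.Prime 7) := ⟨by norm_num⟩

theorem card_SL_two_zmod_seven : Nat.card (Matrix.SpecialLinearGroup (Fin 2) (ZMod 7)) = 336 := by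
  let e : Matrix.SpecialLinearGroup (Fin 2) (ZMod 7) ≃
      {p : (ZMod 7 × ZMod 7) × ZMod 7 × ZMod 7 // p.1.1 * p.2.2 - p.1.2 * p.2.1 = 1} :=
    { toFun := fun g => ⟨((g 0 0, g 0 1), (g 1 0, g 1 1)), by
        rw [← det_fin_two]; exact g.det_coe⟩
      invFun := fun p => ⟨!![p.1.1.1, p.1.1.2; p.1.2.1, p.1.2.2], by
        rw [det_fin_two_of]; exact p.2⟩
      left_inv := fun g => by ext i j; fin_cases i <;> fin_cases j <;> rfl
      right_inv := fun p => rfl }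
  rw [Nat.card_congr e, Nat.card_eq_fintype_card]
  decide +kernel

theorem card_center_SL_two_zmod_seven :
    Nat.card (Subgroup.center (Matrix.SpecialLinearGroup (Fin 2) (ZMod 7))) = 2 := by
  rw [Nat.card_congr (Matrix.SpecialLinearGroup.center_equiv_rootsOfUnity' (0 : Fin 2)).toEquiv,
    Fintype.card_fin]
  exact (IsPrimitiveRoot.neg_one 7 (by norm_num)).card_rootsOfUnity

theorem card_quotient_center_SL_two_zmod_seven :
    Nat.card (Matrix.SpecialLinearGroup (Fin 2) (ZMod 7) ⧸
      Subgroup.center (Matrix.SpecialLinearGroup (Fin 2) (ZMod 7))) = 168 := by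
  have h := Subgroup.card_eq_card_quotient_mul_card_subgroup
    (Subgroup.center (Matrix.SpecialLinearGroup (Fin 2) (ZMod 7)))
  rw [card_SL_two_zmod_seven, card_center_SL_two_zmod_seven] at h
  omega

/-- The upper unitriangular matrix with entry `t`. -/
def upperUni (t : ZMod 7) : Matrix.SpecialLinearGroup (Fin 2) (ZMod 7) :=
  ⟨!![1, t; 0, 1], by simp⟩

/-- The lower unitriangular matrix with entry `t`. -/
def lowerUni (t : ZMod 7) : Matrix.SpecialLinearGroup (Fin 2) (ZMod 7) :=
  ⟨!![1, 0; t, 1], by simp⟩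

theorem coe_upperUni (t : ZMod 7) :
    (upperUni t : Matrix (Fin 2) (Fin 2) (ZMod 7)) = !![1, t; 0, 1] := rfl

theorem coe_lowerUni (t : ZMod 7) :
    (lowerUni t : Matrix (Fin 2) (Fin 2) (ZMod 7)) = !![1, 0; t, 1] := rfl

theorem upperUni_pow (n : ℕ) : upperUni 1 ^ n = upperUni n := by
  induction n with
  | zero => exact Subtype.ext (by simp [coe_upperUni, one_fin_two])
  | succ n ih =>
    rw [pow_succ, ih]
    exact Subtype.ext (by simp [coe_upperUni, add_comm])

theorem lowerUni_pow (n : ℕ) : lowerUni (-1) ^ n = lowerUni (-n) := by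
  induction n with
  | zero => exact Subtype.ext (by simp [coe_lowerUni, one_fin_two])
  | succ n ih =>
    rw [pow_succ, ih]
    exact Subtype.ext (by simp [coe_lowerUni, add_comm])

theorem closure_upperUni_lowerUni :
    Subgroup.closure {upperUni 1, lowerUni (-1)} = ⊤ := by
  set K := Subgroup.closure {upperUni 1, lowerUni (-1)} with hK
  have hU (t : ZMod 7) : upperUni t ∈ K := by
    rw [← ZMod.natCast_zmod_val t, ← upperUni_pow]
    exact K.pow_mem (Subgroup.subset_closure (by simp)) _
  have hL (t : ZMod 7) : lowerUni t ∈ K := by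
    rw [← neg_neg t, ← ZMod.natCast_zmod_val (-t), ← lowerUni_pow]
    exact K.pow_mem (Subgroup.subset_closure (by simp)) _
  have main (g : Matrix.SpecialLinearGroup (Fin 2) (ZMod 7)) (hg : g 1 0 ≠ 0) : g ∈ K := by
    have hd := g.det_coe
    rw [det_fin_two] at hd
    have : g = upperUni ((g 0 0 - 1) / g 1 0) * lowerUni (g 1 0) *
        upperUni ((g 1 1 - 1) / g 1 0) := by
      refine Matrix.SpecialLinearGroup.ext _ _ fun i j => congrFun₂
        (?_ : (g : Matrix (Fin 2) (Fin 2) (ZMod 7)) = _) i j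
      refine (eta_fin_two _).trans ?_
      simp only [Matrix.SpecialLinearGroup.coe_mul, coe_upperUni, coe_lowerUni, mul_fin_two]
      congr! 3
      · field_simp
        ring
      · congr! 1
        field_simp
        linear_combination -hd
      · congr! 1
        · ring
        · congr! 1
          field_simp
          ring
    rw [this]
    exact K.mul_mem (K.mul_mem (hU _) (hL _)) (hU _)
  refine (Subgroup.eq_top_iff' K).2 fun g => ?_
  by_cases hg : g 1 0 = 0
  · rw [← K.mul_mem_cancel_left (hL 1)]
    apply main
    have hd := g.det_coe
    rw [det_fin_two, hg] at hd
    have : g 0 0 ≠ 0 := by rintro h; simp [h] at hd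
    simpa [coe_lowerUni, Matrix.mul_apply, Fin.sum_univ_two, hg]
  · exact main g hg

/-- The braid generator `A` in terms of `z = q ^ 4`. -/
def repA (z : ℂ) : Matrix (Fin 4) (Fin 4) ℂ :=
  !![1, z + z ^ 2 + z ^ 3, z ^ 3 + z ^ 4 + z ^ 5, z ^ 6;
     0, z ^ 3, z ^ 4 + z ^ 5, z ^ 6;
     0, 0, z ^ 5, z ^ 6;
     0, 0, 0, z ^ 6]

/-- The braid generator `B` in terms of `z = q ^ 4`. -/
def repB (z : ℂ) : Matrix (Fin 4) (Fin 4) ℂ :=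
  !![z ^ 6, 0, 0, 0;
     -z ^ 5, z ^ 5, 0, 0;
     z ^ 4, -(z ^ 3 + z ^ 4), z ^ 3, 0;
     -z ^ 3, z + z ^ 2 + z ^ 3, -(1 + z + z ^ 2), 1]

/-- The orbit of a fixed vector of `B` under the powers of `A`. -/
def orbitVec (z : ℂ) : ZMod 7 → Fin 4 → ℂ :=
  ![![0, 0, 0, z ^ 2],
    ![z, z, z, z],
    ![z ^ 4, -(z + z ^ 2 + z ^ 3), 1 + z ^ 6, 1],
    ![-z ^ 5, z ^ 3 + z ^ 4, -(1 + z + z ^ 2 + z ^ 3), z ^ 6],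
    ![z ^ 2, z ^ 2 + z ^ 3, z ^ 2 + z ^ 3 + z ^ 4 + z ^ 5, z ^ 5],
    ![-z ^ 3, -(z ^ 3 + z ^ 4 + z ^ 5), 1 + z + z ^ 2 + z ^ 3 + z ^ 4, z ^ 4],
    ![-z ^ 6, z ^ 5, -z ^ 4, z ^ 3]]

/-- The vector attached to a point of the plane over the field with seven elements. -/
noncomputable def planeVec (z : ℂ) (x : Fin 2 → ZMod 7) : Fin 4 → ℂ :=
  if x 1 = 0 then (quadraticChar (ZMod 7) (x 0) : ℂ) • ![1, 0, 0, 0]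
  else (quadraticChar (ZMod 7) (x 1) : ℂ) • orbitVec z (x 0 / x 1)

variable {z : ℂ}

theorem orbitVec_zero : orbitVec z 0 = ![0, 0, 0, z ^ 2] := rfl

theorem orbitVec_one : orbitVec z 1 = ![z, z, z, z] := rfl

theorem orbitVec_two : orbitVec z 2 = ![z ^ 4, -(z + z ^ 2 + z ^ 3), 1 + z ^ 6, 1] := rfl

theorem orbitVec_three :
    orbitVec z 3 = ![-z ^ 5, z ^ 3 + z ^ 4, -(1 + z + z ^ 2 + z ^ 3), z ^ 6] := rfl

theorem orbitVec_four :
    orbitVec z 4 = ![z ^ 2, z ^ 2 + z ^ 3, z ^ 2 + z ^ 3 + z ^ 4 + z ^ 5, z ^ 5] := rfl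

theorem orbitVec_five : orbitVec z 5 =
    ![-z ^ 3, -(z ^ 3 + z ^ 4 + z ^ 5), 1 + z + z ^ 2 + z ^ 3 + z ^ 4, z ^ 4] := rfl

theorem orbitVec_six : orbitVec z 6 = ![-z ^ 6, z ^ 5, -z ^ 4, z ^ 3] := rfl

theorem zmod_seven_cases (k : ZMod 7) :
    k = 0 ∨ k = 1 ∨ k = 2 ∨ k = 3 ∨ k = 4 ∨ k = 5 ∨ k = 6 := by
  revert k; decide

theorem repA_mulVec_orbitVec (h : 1 + z + z ^ 2 + z ^ 3 + z ^ 4 + z ^ 5 + z ^ 6 = 0) (k : ZMod 7) :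
    repA z *ᵥ orbitVec z k = orbitVec z (k + 1) := by
  have e : (0 + 1 : ZMod 7) = 1 ∧ (1 + 1 : ZMod 7) = 2 ∧ (2 + 1 : ZMod 7) = 3 ∧
      (3 + 1 : ZMod 7) = 4 ∧ (4 + 1 : ZMod 7) = 5 ∧ (5 + 1 : ZMod 7) = 6 ∧
      (6 + 1 : ZMod 7) = 0 := by decide
  rcases zmod_seven_cases k with rfl | rfl | rfl | rfl | rfl | rfl | rfl <;>
    simp only [e, orbitVec_zero, orbitVec_one, orbitVec_two, orbitVec_three, orbitVec_four,
      orbitVec_five, orbitVec_six] <;>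
    ext i <;> fin_cases i <;>
    simp [repA, mulVec, dotProduct, Fin.sum_univ_four] <;> grind

theorem repB_mulVec_orbitVec (h : 1 + z + z ^ 2 + z ^ 3 + z ^ 4 + z ^ 5 + z ^ 6 = 0) (k : ZMod 7)
    (hk : k ≠ 1) :
    repB z *ᵥ orbitVec z k =
      (quadraticChar (ZMod 7) (1 - k) : ℂ) • orbitVec z (k / (1 - k)) := by
  have e : (0 / (1 - 0) : ZMod 7) = 0 ∧ (2 / (1 - 2) : ZMod 7) = 5 ∧ (3 / (1 - 3) : ZMod 7) = 2 ∧
      (4 / (1 - 4) : ZMod 7) = 1 ∧ (5 / (1 - 5) : ZMod 7) = 4 ∧ (6 / (1 - 6) : ZMod 7) = 3 := by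
    refine ⟨?_, ?_, ?_, ?_, ?_, ?_⟩ <;> exact (div_eq_iff (by decide)).2 (by decide)
  have c : quadraticChar (ZMod 7) (1 - 0) = 1 ∧ quadraticChar (ZMod 7) (1 - 2) = -1 ∧
      quadraticChar (ZMod 7) (1 - 3) = -1 ∧ quadraticChar (ZMod 7) (1 - 4) = 1 ∧
      quadraticChar (ZMod 7) (1 - 5) = -1 ∧ quadraticChar (ZMod 7) (1 - 6) = 1 := by
    decide
  rcases zmod_seven_cases k with rfl | rfl | rfl | rfl | rfl | rfl | rfl <;>
    first
    | exact absurd rfl hk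
    | simp only [e, c, orbitVec_zero, orbitVec_one, orbitVec_two, orbitVec_three, orbitVec_four,
        orbitVec_five, orbitVec_six]
      ext i
      fin_cases i <;> simp [repB, mulVec, dotProduct, Fin.sum_univ_four] <;> grind

theorem repB_mulVec_orbitVec_one (h : 1 + z + z ^ 2 + z ^ 3 + z ^ 4 + z ^ 5 + z ^ 6 = 0) :
    repB z *ᵥ orbitVec z 1 = ![1, 0, 0, 0] := by
  rw [orbitVec_one]
  ext i
  fin_cases i <;> simp [repB, mulVec, dotProduct, Fin.sum_univ_four] <;> grind

theorem repA_mulVec_single : repA z *ᵥ ![1, 0, 0, 0] = ![1, 0, 0, 0] := by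
  ext i
  fin_cases i <;> simp [repA, mulVec, dotProduct, Fin.sum_univ_four]

theorem repB_mulVec_single :
    repB z *ᵥ ![1, 0, 0, 0] = -orbitVec z (-1) := by
  rw [show (-1 : ZMod 7) = 6 by decide, orbitVec_six]
  ext i
  fin_cases i <;> simp [repB, mulVec, dotProduct, Fin.sum_univ_four]

theorem repA_mulVec_planeVec (h : 1 + z + z ^ 2 + z ^ 3 + z ^ 4 + z ^ 5 + z ^ 6 = 0)
    (x : Fin 2 → ZMod 7) :
    repA z *ᵥ planeVec z x = planeVec z (upperUni 1 *ᵥ x) := by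
  have hx : upperUni 1 *ᵥ x = ![x 0 + x 1, x 1] := by
    rw [coe_upperUni]
    ext i
    fin_cases i <;> simp [mulVec, dotProduct]
  rw [hx]
  by_cases h1 : x 1 = 0
  · simp [-smul_cons, -quadraticChar_apply, planeVec, h1, mulVec_smul, repA_mulVec_single]
  · simp [planeVec, h1, mulVec_smul, repA_mulVec_orbitVec h, add_div]

theorem repB_mulVec_planeVec (h : 1 + z + z ^ 2 + z ^ 3 + z ^ 4 + z ^ 5 + z ^ 6 = 0)
    (x : Fin 2 → ZMod 7) :
    repB z *ᵥ planeVec z x = planeVec z (lowerUni (-1) *ᵥ x) := by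
  have hx : lowerUni (-1) *ᵥ x = ![x 0, x 1 - x 0] := by
    rw [coe_lowerUni]
    ext i
    fin_cases i <;> simp [mulVec, dotProduct, sub_eq_neg_add]
  have c : quadraticChar (ZMod 7) (-1) = -1 := by decide
  rw [hx]
  by_cases h1 : x 1 = 0
  · by_cases h0 : x 0 = 0
    · simp [planeVec, h1, h0]
    · have : quadraticChar (ZMod 7) (-x 0) = -quadraticChar (ZMod 7) (x 0) := by
        rw [← neg_one_mul, map_mul, c, neg_one_mul]
      simp [-smul_cons, -quadraticChar_apply, planeVec, h1, h0, mulVec_smul, repB_mulVec_single,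
        this]
  · by_cases h0 : x 0 = x 1
    · simp [planeVec, h0, h1, mulVec_smul, repB_mulVec_orbitVec_one h]
    · have h2 : x 1 - x 0 ≠ 0 := sub_ne_zero.2 (Ne.symm h0)
      have h3 : x 0 / x 1 ≠ 1 := by rwa [Ne, div_eq_one_iff_eq h1]
      have h4 : x 0 / x 1 / (1 - x 0 / x 1) = x 0 / (x 1 - x 0) := by
        rw [one_sub_div h1, div_div_div_cancel_right₀ h1]
      have h5 : quadraticChar (ZMod 7) (x 1 - x 0) =
          quadraticChar (ZMod 7) (x 1) * quadraticChar (ZMod 7) (1 - x 0 / x 1) := by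
        rw [← map_mul, mul_sub, mul_one, mul_div_cancel₀ _ h1]
      simp [planeVec, h1, h2, mulVec_smul, repB_mulVec_orbitVec h _ h3, h4, h5, mul_smul]

theorem orbitVec_apply_three (k : ZMod 7) : orbitVec z k 3 = z ^ (2 - k).val := by
  rcases zmod_seven_cases k with rfl | rfl | rfl | rfl | rfl | rfl | rfl
  · rfl
  · exact (pow_one z).symm
  · exact (pow_zero z).symm
  all_goals rfl

theorem planeVec_eq_single (hz : IsPrimitiveRoot z 7) {x : Fin 2 → ZMod 7}
    (h : planeVec z x = ![1, 0, 0, 0]) : x 1 = 0 ∧ quadraticChar (ZMod 7) (x 0) = 1 := by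
  by_cases h1 : x 1 = 0
  · refine ⟨h1, ?_⟩
    have := congrFun h 0
    simpa [planeVec, h1, -quadraticChar_apply] using this
  · have := congrFun h 3
    simp [planeVec, h1, -quadraticChar_apply, orbitVec_apply_three, hz.ne_zero,
      quadraticChar_eq_zero_iff] at this

theorem planeVec_eq_orbitVec (hz : IsPrimitiveRoot z 7) {x : Fin 2 → ZMod 7} {k : ZMod 7}
    (h : planeVec z x = orbitVec z k) :
    x 1 ≠ 0 ∧ quadraticChar (ZMod 7) (x 1) = 1 ∧ x 0 / x 1 = k := by
  have h3 := congrFun h 3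
  by_cases h1 : x 1 = 0
  · simp [planeVec, h1, -quadraticChar_apply, orbitVec_apply_three] at h3
    exact absurd h3.symm (pow_ne_zero _ (hz.ne_zero (by norm_num)))
  · refine ⟨h1, ?_⟩
    rcases quadraticChar_dichotomy h1 with hc | hc
    · refine ⟨hc, ?_⟩
      simp only [planeVec, h1, if_false, hc, Int.cast_one, one_smul, orbitVec_apply_three] at h3
      have := ZMod.val_injective 7 (hz.pow_inj (ZMod.val_lt _) (ZMod.val_lt _) h3)
      exact sub_right_injective this
    · simp only [planeVec, h1, if_false, hc, Int.cast_neg, Int.cast_one, neg_smul, one_smul,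
        Pi.neg_apply, orbitVec_apply_three] at h3
      have h7 := congrArg (· ^ 7) h3
      simp only [Odd.neg_pow (show Odd 7 by decide), ← pow_mul, mul_comm _ 7] at h7
      simp only [pow_mul, hz.pow_eq_one, one_pow] at h7
      norm_num at h7

theorem planeVec_one_zero : planeVec z ![1, 0] = ![1, 0, 0, 0] := by
  simp [planeVec, -quadraticChar_apply]

theorem planeVec_one (k : ZMod 7) : planeVec z ![k, 1] = orbitVec z k := by
  simp [planeVec, -quadraticChar_apply]

theorem eq_one_of_mulVec_planeVec (hz : IsPrimitiveRoot z 7)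
    (h : 1 + z + z ^ 2 + z ^ 3 + z ^ 4 + z ^ 5 + z ^ 6 = 0) {M : Matrix (Fin 4) (Fin 4) ℂ}
    (hM : ∀ x, M *ᵥ planeVec z x = planeVec z x) : M = 1 := by
  have hz0 : z ≠ 0 := hz.ne_zero (by norm_num)
  have hz1 : 1 + z ≠ 0 := by
    intro hz1
    have h7 := hz.pow_eq_one
    rw [eq_neg_of_add_eq_zero_right hz1] at h7
    norm_num at h7
  have hD (x) : (M - 1) *ᵥ planeVec z x = 0 := by rw [sub_mulVec, hM, one_mulVec, sub_self]
  rw [← sub_eq_zero]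
  ext i j
  have e (x) := congrFun (hD x) i
  have e0 := e ![1, 0]
  have e1 := e ![0, 1]
  have e2 := e ![1, 1]
  have e3 := e ![2, 1]
  rw [planeVec_one_zero] at e0
  rw [planeVec_one, orbitVec_zero] at e1
  rw [planeVec_one, orbitVec_one] at e2
  rw [planeVec_one, orbitVec_two] at e3
  generalize M - 1 = D at *
  simp only [mulVec, dotProduct, Fin.sum_univ_four, Pi.zero_apply] at e0 e1 e2 e3
  simp at e0 e1 e2 e3
  have d3 : D i 3 = 0 := by simpa [hz0] using e1
  have d2 : D i 2 = -D i 1 := by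
    apply mul_right_cancel₀ hz0
    linear_combination e2 - z * e0 - z * d3
  have d1 : D i 1 = 0 := by
    have : D i 1 * (z ^ 4 * (1 + z)) = 0 := by
      linear_combination e3 - z ^ 4 * e0 - d3 - (1 + z ^ 6) * d2 + D i 1 * h
    simpa [hz0, hz1] using this
  fin_cases j
  · exact e0
  · exact d1
  · simpa [d1] using d2
  · exact d3

theorem eq_one_of_planeVec_mulVec (hz : IsPrimitiveRoot z 7)
    {s : Matrix.SpecialLinearGroup (Fin 2) (ZMod 7)}
    (hs : ∀ x, planeVec z (s *ᵥ x) = planeVec z x) : s = 1 := by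
  have h0 := planeVec_eq_single hz ((hs ![1, 0]).trans planeVec_one_zero)
  have h1 := planeVec_eq_orbitVec hz ((hs ![0, 1]).trans (planeVec_one 0))
  have h2 := planeVec_eq_orbitVec hz ((hs ![1, 1]).trans (planeVec_one 1))
  have hd := s.det_coe
  have hext : (s : Matrix (Fin 2) (Fin 2) (ZMod 7)) = 1 → s = 1 := fun h =>
    Matrix.SpecialLinearGroup.ext _ _ fun i j => congrFun₂ h i j
  apply hext
  rw [det_fin_two] at hd
  rw [eta_fin_two (s : Matrix (Fin 2) (Fin 2) (ZMod 7)), one_fin_two]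
  simp only [mulVec, dotProduct, Fin.sum_univ_two] at h0 h1 h2
  generalize (s : Matrix (Fin 2) (Fin 2) (ZMod 7)) 0 0 = a at *
  generalize (s : Matrix (Fin 2) (Fin 2) (ZMod 7)) 0 1 = b at *
  generalize (s : Matrix (Fin 2) (Fin 2) (ZMod 7)) 1 0 = c at *
  generalize (s : Matrix (Fin 2) (Fin 2) (ZMod 7)) 1 1 = d at *
  simp [-quadraticChar_apply] at h0 h1 h2
  obtain ⟨rfl, ha⟩ := h0
  obtain ⟨hd0, -, hb⟩ := h1
  obtain rfl : b = 0 := by simpa [hd0] using hb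
  obtain rfl : a = d := by simpa [div_eq_one_iff_eq hd0] using h2.2.2
  have c1 : quadraticChar (ZMod 7) (-1) = -1 := by decide
  rcases mul_self_eq_one_iff.1 (by simpa using hd) with rfl | rfl
  · rfl
  · rw [c1] at ha
    norm_num at ha

/-- The pairs of group elements that act compatibly on the source and target of `v`. -/
def intertwiners (v : (Fin 2 → ZMod 7) → Fin 4 → ℂ) :
    Subgroup ((Matrix (Fin 4) (Fin 4) ℂ)ˣ × Matrix.SpecialLinearGroup (Fin 2) (ZMod 7)) where
  carrier := {p | ∀ x, (p.1 : Matrix (Fin 4) (Fin 4) ℂ) *ᵥ v x = v (p.2 *ᵥ x)}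
  mul_mem' {p p'} hp hp' x := by
    simp only [Prod.fst_mul, Prod.snd_mul, Units.val_mul, Matrix.SpecialLinearGroup.coe_mul,
      ← mulVec_mulVec]
    rw [hp', hp]
  one_mem' x := by simp
  inv_mem' {p} hp x := by
    have hx : v x = (p.1 : Matrix (Fin 4) (Fin 4) ℂ) *ᵥ v
        (((p.2⁻¹ : Matrix.SpecialLinearGroup (Fin 2) (ZMod 7)) :
          Matrix (Fin 2) (Fin 2) (ZMod 7)) *ᵥ x) := by
      rw [hp, mulVec_mulVec, ← Matrix.SpecialLinearGroup.coe_mul, mul_inv_cancel,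
        Matrix.SpecialLinearGroup.coe_one, one_mulVec]
    rw [Prod.fst_inv, Prod.snd_inv, hx, mulVec_mulVec, ← Units.val_mul, inv_mul_cancel,
      Units.val_one, one_mulVec]

theorem nonempty_mulEquiv_closure (hz : IsPrimitiveRoot z 7)
    {a b : (Matrix (Fin 4) (Fin 4) ℂ)ˣ} (ha : (a : Matrix (Fin 4) (Fin 4) ℂ) = repA z)
    (hb : (b : Matrix (Fin 4) (Fin 4) ℂ) = repB z) :
    Nonempty (Subgroup.closure {a, b} ≃* Matrix.SpecialLinearGroup (Fin 2) (ZMod 7)) := by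
  have h : 1 + z + z ^ 2 + z ^ 3 + z ^ 4 + z ^ 5 + z ^ 6 = 0 := by
    simpa [Finset.sum_range_succ] using hz.geom_sum_eq_zero (by norm_num)
  set H := Subgroup.closure {(a, upperUni 1), (b, lowerUni (-1))}
  have hH : H ≤ intertwiners (planeVec z) := by
    rw [Subgroup.closure_le]
    rintro _ (rfl | rfl) x
    · simpa only [ha] using repA_mulVec_planeVec h x
    · simpa only [hb] using repB_mulVec_planeVec h x
  have injFst : Function.Injective ((MonoidHom.fst _ _).comp H.subtype) := by
    rw [injective_iff_map_eq_one]
    rintro ⟨⟨g, s⟩, hp⟩ (rfl : g = 1)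
    obtain rfl : s = 1 := eq_one_of_planeVec_mulVec hz fun x => by simpa using (hH hp x).symm
    rfl
  have injSnd : Function.Injective ((MonoidHom.snd _ _).comp H.subtype) := by
    rw [injective_iff_map_eq_one]
    rintro ⟨⟨g, s⟩, hp⟩ (rfl : s = 1)
    obtain rfl : g = 1 := Units.ext <| eq_one_of_mulVec_planeVec hz h fun x => by
      simpa using hH hp x
    rfl
  have rangeFst : ((MonoidHom.fst _ _).comp H.subtype).range = Subgroup.closure {a, b} := by
    rw [MonoidHom.range_comp, Subgroup.range_subtype, MonoidHom.map_closure, Set.image_pair]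
    rfl
  have rangeSnd : ((MonoidHom.snd _ _).comp H.subtype).range = ⊤ := by
    rw [MonoidHom.range_comp, Subgroup.range_subtype, MonoidHom.map_closure, Set.image_pair]
    exact closure_upperUni_lowerUni
  exact ⟨(MulEquiv.subgroupCongr rangeFst).symm.trans <|
    (MonoidHom.ofInjective injFst).symm.trans <| (MonoidHom.ofInjective injSnd).trans <|
    (MulEquiv.subgroupCongr rangeSnd).trans Subgroup.topEquiv⟩

theorem card_quotient_center_congr {G K : Type*} [Group G] [Group K] (e : G ≃* K) :
    Nat.card (G ⧸ Subgroup.center G) = Nat.card (K ⧸ Subgroup.center K) := by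
  refine Nat.card_congr (QuotientGroup.congr _ _ e ?_).toEquiv
  ext k
  simp only [Subgroup.mem_map, Subgroup.mem_center_iff]
  constructor
  · rintro ⟨g, hg, rfl⟩ k
    obtain ⟨g', rfl⟩ := e.surjective k
    simp [← map_mul, hg g']
  · intro hk
    refine ⟨e.symm k, fun g => e.injective ?_, by simp⟩
    simpa using hk (e g)

theorem isUnit_repA (hz : z ≠ 0) : IsUnit (repA z) := by
  rw [isUnit_iff_isUnit_det]
  simp [repA, det_succ_row_zero, Fin.sum_univ_succ, Fin.succAbove, hz]

theorem isUnit_repB (hz : z ≠ 0) : IsUnit (repB z) := by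
  rw [isUnit_iff_isUnit_det]
  simp [repB, det_succ_row_zero, Fin.sum_univ_succ, Fin.succAbove, hz]

theorem matGenGroup_eq_closure (a b : (Matrix (Fin 4) (Fin 4) ℂ)ˣ) :
    matGenGroup a b = Subgroup.closure {a, b} := by
  rw [matGenGroup]
  congr 1
  ext g
  simp [Units.ext_iff]

end

theorem stmt19 (q : ℂ) (hq : q = Complex.exp (Real.pi * Complex.I / 14))
    (A B : Matrix (Fin 4) (Fin 4) ℂ)
    (hA : A = !![1, (q ^ 8 + q ^ 4 + 1) * q ^ 4, -(q ^ 8 + q ^ 4 + 1) / q ^ 2, -q ^ 10;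
                 0, q ^ 12, -(q ^ 4 + 1) * q ^ 2, -q ^ 10;
                 0, 0, -q ^ 6, -q ^ 10;
                 0, 0, 0, -q ^ 10])
    (hB : B = !![-q ^ 10, 0, 0, 0;
                 q ^ 6, -q ^ 6, 0, 0;
                 q ^ 16, -(q ^ 4 + 1) * q ^ 12, q ^ 12, 0;
                 -q ^ 12, q ^ 12 + q ^ 8 + q ^ 4, -q ^ 8 - q ^ 4 - 1, 1]) :
    Set.Finite (matGenGroup A B : Set (Matrix (Fin 4) (Fin 4) ℂ)ˣ) ∧
      Nat.card ((matGenGroup A B) ⧸ Subgroup.center (matGenGroup A B)) = 168 := by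
  have hq28 : IsPrimitiveRoot q 28 := by
    have := Complex.isPrimitiveRoot_exp 28 (by norm_num)
    rw [hq]
    convert this using 2
    push_cast
    ring
  have hz : IsPrimitiveRoot (q ^ 4) 7 := hq28.pow (by norm_num) (by norm_num)
  have hq0 : q ≠ 0 := hq28.ne_zero (by norm_num)
  have hq2 : q ^ 2 ≠ 0 := pow_ne_zero 2 hq0
  have h14 : q ^ 14 = -1 :=
    (hq28.pow (by norm_num) (show 28 = 14 * 2 by norm_num)).eq_neg_one_of_two_right
  have hA' : A = repA (q ^ 4) := by
    rw [hA, repA]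
    ext i j
    fin_cases i <;> fin_cases j <;> simp <;> grind
  have hB' : B = repB (q ^ 4) := by
    rw [hB, repB]
    ext i j
    fin_cases i <;> fin_cases j <;> simp <;> grind
  obtain ⟨a, ha⟩ := isUnit_repA (pow_ne_zero 4 hq0)
  obtain ⟨b, hb⟩ := isUnit_repB (pow_ne_zero 4 hq0)
  obtain ⟨e⟩ := nonempty_mulEquiv_closure hz ha hb
  rw [hA', hB', ← ha, ← hb, matGenGroup_eq_closure]
  refine ⟨?_, (card_quotient_center_congr e).trans card_quotient_center_SL_two_zmod_seven⟩
  have := Finite.of_equiv _ e.symm.toEquiv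
  exact Set.toFinite _
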